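/- For every ε > 0 there exist δ > 0 and a positive integer M with the following property. Let V1, V2, V3 be finite non-empty sets and let E12 ⊆ V1 × V2, E23 ⊆ V2 × V3, E31 ⊆ V3 × V1 be such that the number of triples (x1, x2, x3) with (x1, x2) ∈ E12, (x2, x3) ∈ E23 and (x3, x1) ∈ E31 is at most δ|V1||V2||V3|. Then there exist sets E'12 ⊆ V1 × V2, E'23 ⊆ V2 × V3, E'31 ⊆ V3 × V1 containing no triangle whatsoever, with |E_ij \ E'_ij| ≤ ε|V_i||V_j| for each ij = 12, 23, 31, and furthermore there exist partitions V_i = V_{i,1} ∪ … ∪ V_{i,M} for i = 1, 2, 3 into (possibly empty) pieces such that for each ij = 12, 23, 31 the set E'_ij is a union of sets of the form V_{i,a} × V_{j,b}. -/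

import Mathlib

open scoped Classical BigOperators

open Finset SimpleGraph

/-- The pair of cells `(A, B)` is `η ^ 2 / 4`-regular, and its trace on `T × T'` is large and
has density at least `η`. -/
def RegularDense {X : Type*} (G : SimpleGraph X) (η : ℝ) (T T' A B : Finset X) : Prop :=
  A ≠ B ∧ G.IsUniform (η ^ 2 / 4) A B ∧ η * #A ≤ #(A ∩ T) ∧ η * #B ≤ #(B ∩ T') ∧
    η ≤ G.edgeDensity (A ∩ T) (B ∩ T')

lemma SimpleGraph.IsUniform.subset {X : Type*} {G : SimpleGraph X} {η : ℝ} {A B s t : Finset X}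
    (hη : 0 < η) (hη1 : η ≤ 1) (h : G.IsUniform (η ^ 2 / 4) A B) (hs : s ⊆ A) (ht : t ⊆ B)
    (hsA : η * #A ≤ #s) (htB : η * #B ≤ #t) : G.IsUniform (η / 2) s t := by
  have hAB := h hs ht (by nlinarith [Nat.cast_nonneg (α := ℝ) #A])
    (by nlinarith [Nat.cast_nonneg (α := ℝ) #B])
  intro s' hs' t' ht' hs'' ht''
  have h' := h (hs'.trans hs) (ht'.trans ht)
    (by nlinarith [Nat.cast_nonneg (α := ℝ) #A]) (by nlinarith [Nat.cast_nonneg (α := ℝ) #B])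
  rw [abs_lt] at *
  constructor <;> nlinarith

lemma card_le_of_regularDense {X : Type*} [Fintype X] {G : SimpleGraph X} {η : ℝ} (hη : 0 < η)
    (hη1 : η ≤ 1 / 2) {T₁ T₂ T₃ A B C : Finset X} (hAB : RegularDense G η T₁ T₂ A B)
    (hBC : RegularDense G η T₂ T₃ B C) (hCA : RegularDense G η T₃ T₁ C A) :
    η ^ 6 / 16 * (#A * #B * #C) ≤
      #{p : X × X × X | p.1 ∈ T₁ ∧ p.2.1 ∈ T₂ ∧ p.2.2 ∈ T₃ ∧
        G.Adj p.1 p.2.1 ∧ G.Adj p.2.1 p.2.2 ∧ G.Adj p.2.2 p.1} := by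
  obtain ⟨-, uAB, hA, hB, dAB⟩ := hAB
  obtain ⟨-, uBC, -, hC, dBC⟩ := hBC
  obtain ⟨-, uCA, -, -, dCA⟩ := hCA
  rw [edgeDensity_comm] at dCA
  have count := G.triangle_counting' (ε := η / 2) (s := A ∩ T₁) (t := B ∩ T₂) (u := C ∩ T₃)
    (by linarith) (uAB.subset hη (by linarith) inter_subset_left inter_subset_left hA hB)
    (by linarith) (uCA.symm.subset hη (by linarith) inter_subset_left inter_subset_left hA hC)
    (by linarith) (uBC.subset hη (by linarith) inter_subset_left inter_subset_left hB hC)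
  calc
    _ = 1 / 2 * (η / 2) ^ 3 * ((η * #A) * (η * #B) * (η * #C)) := by ring
    _ ≤ (1 - 2 * (η / 2)) * (η / 2) ^ 3 * (#(A ∩ T₁) * #(B ∩ T₂) * #(C ∩ T₃)) := by
      have : 0 ≤ 1 - 2 * (η / 2) := by linarith
      gcongr
      linarith
    _ ≤ _ := by
      simp only [← mul_assoc]
      refine count.trans (Nat.cast_le.2 (card_le_card fun p hp ↦ ?_))
      simp only [mem_filter, mem_product, mem_inter] at hp
      simp only [mem_filter, mem_univ, true_and]
      exact ⟨hp.1.1.2, hp.1.2.1.2, hp.1.2.2.2, hp.2.1, hp.2.2.2, hp.2.2.1.symm⟩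

lemma Finpartition.card_small_trace_le {X : Type*} [Fintype X] (P : Finpartition (univ : Finset X))
    {η : ℝ} (hη : 0 < η) (T : Finset X) :
    (#{x ∈ T | #(P.part x ∩ T) < η * #(P.part x)} : ℝ) ≤ η * Fintype.card X := by
  have hsub : ({x ∈ T | #(P.part x ∩ T) < η * #(P.part x)} : Finset X) ⊆
      {A ∈ P.parts | (#(A ∩ T) : ℝ) < η * #A}.biUnion (fun A ↦ A ∩ T) := by
    intro x hx
    rw [mem_filter] at hx
    have hm := P.part_mem.2 (mem_univ x)
    have hm' := P.mem_part (mem_univ x)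
    simp only [mem_biUnion, mem_filter, mem_inter]
    exact ⟨_, ⟨hm, hx.2⟩, hm', hx.1⟩
  calc
    _ ≤ ∑ A ∈ P.parts with (#(A ∩ T) : ℝ) < η * #A, (#(A ∩ T) : ℝ) := by
      exact_mod_cast (card_le_card hsub).trans card_biUnion_le
    _ ≤ ∑ A ∈ P.parts with (#(A ∩ T) : ℝ) < η * #A, η * #A :=
      sum_le_sum fun A hA ↦ (mem_filter.1 hA).2.le
    _ ≤ ∑ A ∈ P.parts, η * #A :=
      sum_le_sum_of_subset_of_nonneg (filter_subset _ _) fun _ _ _ ↦ by positivity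
    _ = η * Fintype.card X := by
      rw [← mul_sum, ← Nat.cast_sum, P.sum_card_parts, card_univ]

lemma SimpleGraph.card_interedges_eq {X : Type*} (G : SimpleGraph X) (s t : Finset X) :
    (#(G.interedges s t) : ℝ) = G.edgeDensity s t * (#s * #t) := by
  obtain rfl | hs := s.eq_empty_or_nonempty
  · simp
  obtain rfl | ht := t.eq_empty_or_nonempty
  · simp [interedges, Rel.interedges]
  have := hs.card_pos
  have := ht.card_pos
  rw [edgeDensity_def]
  push_cast
  field_simp

lemma Finpartition.card_sparse_trace_le {X : Type*} [Fintype X]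
    (P : Finpartition (univ : Finset X)) (G : SimpleGraph X) {η : ℝ} (hη : 0 < η)
    (T T' : Finset X) :
    (#{p : X × X | p.1 ∈ T ∧ p.2 ∈ T' ∧ G.Adj p.1 p.2 ∧
      G.edgeDensity (P.part p.1 ∩ T) (P.part p.2 ∩ T') < η} : ℝ) ≤ η * Fintype.card X ^ 2 := by
  have hsub : ({p : X × X | p.1 ∈ T ∧ p.2 ∈ T' ∧ G.Adj p.1 p.2 ∧
      G.edgeDensity (P.part p.1 ∩ T) (P.part p.2 ∩ T') < η} : Finset (X × X)) ⊆
      {q ∈ P.parts ×ˢ P.parts | (G.edgeDensity (q.1 ∩ T) (q.2 ∩ T') : ℝ) < η}.biUnion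
        (fun q ↦ G.interedges (q.1 ∩ T) (q.2 ∩ T')) := by
    rintro ⟨x, y⟩ hx
    simp only [mem_filter, mem_univ, true_and] at hx
    simp only [mem_biUnion, mem_filter, mem_product, mk_mem_interedges_iff, mem_inter]
    exact ⟨(P.part x, P.part y), ⟨⟨P.part_mem.2 (mem_univ x), P.part_mem.2 (mem_univ y)⟩,
      hx.2.2.2⟩, ⟨P.mem_part (mem_univ x), hx.1⟩, ⟨P.mem_part (mem_univ y), hx.2.1⟩, hx.2.2.1⟩
  calc
    _ ≤ ∑ q ∈ P.parts ×ˢ P.parts with (G.edgeDensity (q.1 ∩ T) (q.2 ∩ T') : ℝ) < η,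
        (#(G.interedges (q.1 ∩ T) (q.2 ∩ T')) : ℝ) := by
      exact_mod_cast (card_le_card hsub).trans card_biUnion_le
    _ ≤ ∑ q ∈ P.parts ×ˢ P.parts with (G.edgeDensity (q.1 ∩ T) (q.2 ∩ T') : ℝ) < η,
        η * (#q.1 * #q.2) := by
      refine sum_le_sum fun q hq ↦ ?_
      rw [card_interedges_eq]
      have := (mem_filter.1 hq).2.le
      gcongr <;> exact inter_subset_left
    _ ≤ ∑ q ∈ P.parts ×ˢ P.parts, η * (#q.1 * #q.2) :=
      sum_le_sum_of_subset_of_nonneg (filter_subset _ _) fun _ _ _ ↦ by positivity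
    _ = η * Fintype.card X ^ 2 := by
      simp only [sum_product, ← mul_sum, ← sum_mul]
      rw [← Nat.cast_sum, P.sum_card_parts, card_univ, sq]

lemma Finpartition.card_not_regularDense_le {X : Type*} [Fintype X] [Nonempty X]
    {P : Finpartition (univ : Finset X)} {G : SimpleGraph X} {η : ℝ} (hη : 0 < η) (hη1 : η ≤ 1)
    (hP : P.IsEquipartition) (hPη : 4 / η ≤ #P.parts) (hG : P.IsUniform G (η ^ 2 / 4))
    (T T' : Finset X) :
    (#{p : X × X | p.1 ∈ T ∧ p.2 ∈ T' ∧ G.Adj p.1 p.2 ∧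
      ¬ RegularDense G η T T' (P.part p.1) (P.part p.2)} : ℝ) ≤ 5 * η * Fintype.card X ^ 2 := by
  have hdiag := hP.card_biUnion_offDiag_le hη hPη
  have hirreg := hP.sum_nonUniforms_lt univ_nonempty (by positivity) hG
  have hsmall := P.card_small_trace_le hη T
  have hsmall' := P.card_small_trace_le hη T'
  have hsparse := P.card_sparse_trace_le G hη T T'
  set D := P.parts.biUnion offDiag
  set I := (P.nonUniforms G (η ^ 2 / 4)).biUnion fun (U, V) ↦ U ×ˢ V
  set F : Finset X := {x ∈ T | #(P.part x ∩ T) < η * #(P.part x)}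
  set F' : Finset X := {x ∈ T' | #(P.part x ∩ T') < η * #(P.part x)}
  set S : Finset (X × X) := {p : X × X | p.1 ∈ T ∧ p.2 ∈ T' ∧ G.Adj p.1 p.2 ∧
      G.edgeDensity (P.part p.1 ∩ T) (P.part p.2 ∩ T') < η}
  have hsub : ({p : X × X | p.1 ∈ T ∧ p.2 ∈ T' ∧ G.Adj p.1 p.2 ∧
      ¬ RegularDense G η T T' (P.part p.1) (P.part p.2)} : Finset (X × X)) ⊆
      D ∪ (I ∪ (F ×ˢ univ ∪ (univ ×ˢ F' ∪ S))) := by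
    rintro ⟨x, y⟩ h
    simp only [mem_filter, mem_univ, true_and] at h
    obtain ⟨hx, hy, hxy, hn⟩ := h
    have hx' := P.part_mem.2 (mem_univ x)
    have hy' := P.part_mem.2 (mem_univ y)
    have hxx := P.mem_part (mem_univ x)
    have hyy := P.mem_part (mem_univ y)
    simp only [mem_union]
    by_contra! hcon
    obtain ⟨hD, hI, hF, hF', hS⟩ := hcon
    have hne : P.part x ≠ P.part y := fun he ↦
      hD (mem_biUnion.2 ⟨_, hx', mem_offDiag.2 ⟨hxx, he ▸ hyy, hxy.ne⟩⟩)
    refine hn ⟨hne, ?_, ?_, ?_, ?_⟩ <;> by_contra hc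
    · exact hI (mem_biUnion.2 ⟨(P.part x, P.part y),
        P.mk_mem_nonUniforms G |>.2 ⟨hx', hy', hne, hc⟩, mem_product.2 ⟨hxx, hyy⟩⟩)
    · exact hF (mem_product.2 ⟨mem_filter.2 ⟨hx, not_le.1 hc⟩, mem_univ _⟩)
    · exact hF' (mem_product.2 ⟨mem_univ _, mem_filter.2 ⟨hy, not_le.1 hc⟩⟩)
    · exact hS (mem_filter.2 ⟨mem_univ _, hx, hy, hxy, not_le.1 hc⟩)
  have hle : (#(D ∪ (I ∪ (F ×ˢ univ ∪ (univ ×ˢ F' ∪ S)))) : ℝ) ≤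
      #D + (#I + (#F * Fintype.card X + (Fintype.card X * #F' + #S))) := by
    have h1 := card_union_le D (I ∪ (F ×ˢ univ ∪ (univ ×ˢ F' ∪ S)))
    have h2 := card_union_le I (F ×ˢ univ ∪ (univ ×ˢ F' ∪ S))
    have h3 := card_union_le (F ×ˢ (univ : Finset X)) (univ ×ˢ F' ∪ S)
    have h4 := card_union_le ((univ : Finset X) ×ˢ F') S
    rw [card_product, card_univ] at h3 h4
    exact_mod_cast (by omega)
  have hsub' : (_ : ℝ) ≤ _ := Nat.cast_le.2 (card_le_card hsub)
  rw [card_univ] at hdiag hirreg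
  have hN : (0 : ℝ) ≤ Fintype.card X := by positivity
  nlinarith [mul_le_mul_of_nonneg_right hsmall hN, mul_le_mul_of_nonneg_left hsmall' hN,
    mul_le_mul_of_nonneg_right (mul_le_of_le_one_right hη.le hη1) (sq_nonneg (Fintype.card X : ℝ)),
    mul_nonneg hη.le (sq_nonneg (Fintype.card X : ℝ))]

lemma Finpartition.IsEquipartition.card_le_mul_card_part {X : Type*} [Fintype X]
    {P : Finpartition (univ : Finset X)} (hP : P.IsEquipartition) {A : Finset X}
    (hA : A ∈ P.parts) : Fintype.card X ≤ 2 * #P.parts * #A := by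
  have h1 := hP.average_le_card_part hA
  have h2 := (P.nonempty_of_mem_parts hA).card_pos
  have h3 := P.card_parts_le_card
  rw [card_univ] at h1 h3
  have h4 : 0 < #P.parts := card_pos.2 ⟨A, hA⟩
  have h5 := Nat.lt_mul_div_succ (Fintype.card X) h4
  nlinarith

/-- Every sufficiently large graph has a vertex colouring with boundedly many colours from which
its edges between any two vertex classes can be approximated, in such a way that a triangle in
the approximation forces many triangles in the graph. -/
theorem exists_coloring_approximation {η : ℝ} (hη : 0 < η) (hη1 : η ≤ 1 / 2) :
    ∃ δ : ℝ, 0 < δ ∧ ∃ M L : ℕ, 0 < M ∧ ∀ (X : Type) [Fintype X] [Nonempty X] (G : SimpleGraph X),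
      L ≤ Fintype.card X →
      ∃ (c : X → Fin M) (S : Finset X → Finset X → Fin M → Fin M → Prop),
        (∀ T T' : Finset X, (#{p : X × X | p.1 ∈ T ∧ p.2 ∈ T' ∧ G.Adj p.1 p.2 ∧
          ¬ S T T' (c p.1) (c p.2)} : ℝ) ≤ 5 * η * Fintype.card X ^ 2) ∧
        ∀ T₁ T₂ T₃ : Finset X,
          (#{p : X × X × X | p.1 ∈ T₁ ∧ p.2.1 ∈ T₂ ∧ p.2.2 ∈ T₃ ∧
            G.Adj p.1 p.2.1 ∧ G.Adj p.2.1 p.2.2 ∧ G.Adj p.2.2 p.1} : ℝ) ≤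
            δ * Fintype.card X ^ 3 →
          ∀ x y z, ¬ (S T₁ T₂ (c x) (c y) ∧ S T₂ T₃ (c y) (c z) ∧ S T₃ T₁ (c z) (c x)) := by
  set L := ⌈4 / η⌉₊
  set M := SzemerediRegularity.bound (η ^ 2 / 4) L
  have hM : 0 < M := SzemerediRegularity.bound_pos _ _
  refine ⟨η ^ 6 / 256 / M ^ 3, by positivity, M, L, hM, fun X _ _ G hL ↦ ?_⟩
  obtain ⟨P, hP, hPL, hPM, hPG⟩ := szemeredi_regularity G (by positivity : 0 < η ^ 2 / 4) hL
  obtain ⟨f⟩ : Nonempty (P.parts ↪ Fin M) :=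
    Function.Embedding.nonempty_of_card_le (by simpa using hPM)
  let cell (x : X) : P.parts := ⟨P.part x, P.part_mem.2 (mem_univ x)⟩
  let S (T T' : Finset X) (a b : Fin M) : Prop :=
    ∃ A B : P.parts, f A = a ∧ f B = b ∧ RegularDense G η T T' A B
  have hS (T T' : Finset X) (x y : X) :
      S T T' (f (cell x)) (f (cell y)) ↔ RegularDense G η T T' (P.part x) (P.part y) := by
    constructor
    · rintro ⟨A, B, hA, hB, h⟩
      rwa [f.injective hA, f.injective hB] at h
    · exact fun h ↦ ⟨_, _, rfl, rfl, h⟩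
  refine ⟨fun x ↦ f (cell x), S, fun T T' ↦ ?_, fun T₁ T₂ T₃ hT x y z h ↦ ?_⟩
  · simp only [hS]
    exact P.card_not_regularDense_le hη (by linarith) hP ((Nat.le_ceil _).trans (mod_cast hPL)) hPG T T'
  · simp only [hS] at h
    have hlow := (card_le_of_regularDense hη hη1 h.1 h.2.1 h.2.2).trans hT
    have hpart (x : X) : (Fintype.card X : ℝ) / (2 * M) ≤ #(P.part x) := by
      rw [div_le_iff₀ (by positivity)]
      have := hP.card_le_mul_card_part (P.part_mem.2 (mem_univ x))
      have h' : Fintype.card X ≤ 2 * M * #(P.part x) := this.trans (by gcongr)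
      rw [mul_comm]
      exact_mod_cast h'
    have hprod : (Fintype.card X / (2 * M) * (Fintype.card X / (2 * M)) *
        (Fintype.card X / (2 * M)) : ℝ) ≤ #(P.part x) * #(P.part y) * #(P.part z) := by
      gcongr <;> exact hpart _
    have hpos : 0 < (Fintype.card X : ℝ) := by exact_mod_cast Fintype.card_pos
    have := (mul_le_mul_of_nonneg_left hprod (by positivity : 0 ≤ η ^ 6 / 16)).trans hlow
    have hlt : 0 < η ^ 6 / 256 / M ^ 3 * (Fintype.card X : ℝ) ^ 3 := by positivity
    have heq : η ^ 6 / 16 * (Fintype.card X / (2 * M) * (Fintype.card X / (2 * M)) *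
        (Fintype.card X / (2 * M)) : ℝ) =
        2 * (η ^ 6 / 256 / M ^ 3 * (Fintype.card X : ℝ) ^ 3) := by
      field_simp
      norm_num
    linarith

/-- The tripartite graph on `X₁ ⊕ X₂ ⊕ X₃` given by three relations between the classes. -/
def tripartiteGraph {X₁ X₂ X₃ : Type*} (r₁₂ : X₁ → X₂ → Prop) (r₂₃ : X₂ → X₃ → Prop)
    (r₃₁ : X₃ → X₁ → Prop) : SimpleGraph (X₁ ⊕ X₂ ⊕ X₃) where
  Adj
    | .inl x, .inr (.inl y) | .inr (.inl y), .inl x => r₁₂ x y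
    | .inr (.inl y), .inr (.inr z) | .inr (.inr z), .inr (.inl y) => r₂₃ y z
    | .inr (.inr z), .inl x | .inl x, .inr (.inr z) => r₃₁ z x
    | _, _ => False
  symm.symm := by rintro (x | y | z) (x | y | z) h <;> exact h
  loopless.irrefl := by rintro (x | y | z) h <;> exact h

theorem exists_tripartite_coloring_approximation {ε : ℝ} (hε : 0 < ε) :
    ∃ δ : ℝ, 0 < δ ∧ ∃ M L : ℕ, 0 < M ∧ ∀ (X₁ X₂ X₃ : Type) [Fintype X₁] [Fintype X₂] [Fintype X₃]
      (n : ℕ) (r₁₂ : X₁ → X₂ → Prop) (r₂₃ : X₂ → X₃ → Prop) (r₃₁ : X₃ → X₁ → Prop),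
      Fintype.card X₁ = n → Fintype.card X₂ = n → Fintype.card X₃ = n → 0 < n → L ≤ n →
      (#{p : X₁ × X₂ × X₃ | r₁₂ p.1 p.2.1 ∧ r₂₃ p.2.1 p.2.2 ∧ r₃₁ p.2.2 p.1} : ℝ) ≤ δ * n ^ 3 →
      ∃ (c₁ : X₁ → Fin M) (c₂ : X₂ → Fin M) (c₃ : X₃ → Fin M) (S₁₂ S₂₃ S₃₁ : Fin M → Fin M → Prop),
        (∀ x y z, ¬ (S₁₂ (c₁ x) (c₂ y) ∧ S₂₃ (c₂ y) (c₃ z) ∧ S₃₁ (c₃ z) (c₁ x))) ∧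
        (#{p : X₁ × X₂ | r₁₂ p.1 p.2 ∧ ¬ S₁₂ (c₁ p.1) (c₂ p.2)} : ℝ) ≤ ε * n ^ 2 ∧
        (#{p : X₂ × X₃ | r₂₃ p.1 p.2 ∧ ¬ S₂₃ (c₂ p.1) (c₃ p.2)} : ℝ) ≤ ε * n ^ 2 ∧
        (#{p : X₃ × X₁ | r₃₁ p.1 p.2 ∧ ¬ S₃₁ (c₃ p.1) (c₁ p.2)} : ℝ) ≤ ε * n ^ 2 := by
  set η := min (1 / 2) (ε / 45)
  have hη : 0 < η := by positivity
  have hηε : η ≤ ε / 45 := min_le_right _ _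
  obtain ⟨δ, hδ, M, L, hM, key⟩ := exists_coloring_approximation hη (min_le_left _ _)
  refine ⟨δ, hδ, M, L, hM, fun X₁ X₂ X₃ _ _ _ n r₁₂ r₂₃ r₃₁ h₁ h₂ h₃ hn hL htri ↦ ?_⟩
  let : DecidableEq (X₁ ⊕ X₂ ⊕ X₃) := fun a b ↦ Classical.propDecidable (a = b)
  let i₁ : X₁ → X₁ ⊕ X₂ ⊕ X₃ := .inl
  let i₂ : X₂ → X₁ ⊕ X₂ ⊕ X₃ := fun y ↦ .inr (.inl y)
  let i₃ : X₃ → X₁ ⊕ X₂ ⊕ X₃ := fun z ↦ .inr (.inr z)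
  have inj₁ : i₁.Injective := Sum.inl_injective
  have inj₂ : i₂.Injective := Sum.inr_injective.comp Sum.inl_injective
  have inj₃ : i₃.Injective := Sum.inr_injective.comp Sum.inr_injective
  have hcard : Fintype.card (X₁ ⊕ X₂ ⊕ X₃) = 3 * n := by
    simp only [Fintype.card_sum, h₁, h₂, h₃]; ring
  have : Nonempty (X₁ ⊕ X₂ ⊕ X₃) := Fintype.card_pos_iff.1 (by omega)
  obtain ⟨c, S, happrox, hfree⟩ :=
    key (X₁ ⊕ X₂ ⊕ X₃) (tripartiteGraph r₁₂ r₂₃ r₃₁) (by omega)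
  rw [hcard] at happrox hfree
  have hbound {Y Z : Type} [Fintype Y] [Fintype Z] (i : Y → X₁ ⊕ X₂ ⊕ X₃)
      (j : Z → X₁ ⊕ X₂ ⊕ X₃) (hi : i.Injective) (hj : j.Injective) (r : Y → Z → Prop)
      (hr : ∀ y z, r y z → (tripartiteGraph r₁₂ r₂₃ r₃₁).Adj (i y) (j z)) :
      (#{p : Y × Z | r p.1 p.2 ∧
        ¬ S (univ.image i) (univ.image j) (c (i p.1)) (c (j p.2))} : ℝ) ≤ ε * n ^ 2 := by
    have hle := (happrox (univ.image i) (univ.image j)).trans' <| Nat.cast_le.2 <|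
      card_le_card_of_injOn (Prod.map i j)
      (s := {p : Y × Z | r p.1 p.2 ∧ ¬ S (univ.image i) (univ.image j) (c (i p.1)) (c (j p.2))})
      (fun p hp ↦ by
        rw [mem_coe, mem_filter] at hp ⊢
        exact ⟨mem_univ _, mem_image_of_mem _ (mem_univ _), mem_image_of_mem _ (mem_univ _),
          hr _ _ hp.2.1, hp.2.2⟩)
      (hi.prodMap hj).injOn
    push_cast at hle
    nlinarith [sq_nonneg (n : ℝ)]
  refine ⟨c ∘ i₁, c ∘ i₂, c ∘ i₃, S (univ.image i₁) (univ.image i₂),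
    S (univ.image i₂) (univ.image i₃), S (univ.image i₃) (univ.image i₁), fun x y z ↦ ?_,
    hbound i₁ i₂ inj₁ inj₂ r₁₂ fun _ _ h ↦ h, hbound i₂ i₃ inj₂ inj₃ r₂₃ fun _ _ h ↦ h,
    hbound i₃ i₁ inj₃ inj₁ r₃₁ fun _ _ h ↦ h⟩
  refine hfree _ _ _ ?_ _ _ _
  refine (Nat.cast_le.2 ((card_le_card (t := ({p | r₁₂ p.1 p.2.1 ∧ r₂₃ p.2.1 p.2.2 ∧
    r₃₁ p.2.2 p.1} : Finset (X₁ × X₂ × X₃)).image (Prod.map i₁ (Prod.map i₂ i₃))) ?_).trans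
    card_image_le)).trans (htri.trans ?_)
  · rintro ⟨_, _, _⟩ hp
    simp only [mem_filter, mem_univ, true_and, mem_image] at hp
    obtain ⟨⟨x, rfl⟩, ⟨y, rfl⟩, ⟨z, rfl⟩, h⟩ := hp
    exact mem_image.2 ⟨(x, y, z), mem_filter.2 ⟨mem_univ _, h⟩, rfl⟩
  push_cast
  gcongr
  linarith

lemma sum_card_slice {V V' U U' : Type*} [Fintype V] [Fintype V'] [Fintype U] [Fintype U']
    (p : V × U → V' × U' → Prop) [∀ x y, Decidable (p x y)] :
    ∑ u, ∑ u', #{v : V × V' | p (v.1, u) (v.2, u')} =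
      #{x : (V × U) × (V' × U') | p x.1 x.2} := by
  simp only [card_filter, Fintype.sum_prod_type]
  rw [sum_congr rfl fun u _ ↦ sum_comm, sum_comm]
  exact sum_congr rfl fun v _ ↦ sum_congr rfl fun u _ ↦ sum_comm

lemma exists_forall_le_of_sum_le {U₁ U₂ U₃ : Type*} [Fintype U₁] [Fintype U₂] [Fintype U₃]
    [Nonempty U₁] [Nonempty U₂] [Nonempty U₃] {ε : ℝ} (f : U₁ → U₂ → ℝ) (g : U₂ → U₃ → ℝ)
    (h : U₃ → U₁ → ℝ) (hf : ∀ a b, 0 ≤ f a b) (hg : ∀ a b, 0 ≤ g a b) (hh : ∀ a b, 0 ≤ h a b)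
    (sf : ∑ a, ∑ b, f a b ≤ ε / 3 * (Fintype.card U₁ * Fintype.card U₂))
    (sg : ∑ a, ∑ b, g a b ≤ ε / 3 * (Fintype.card U₂ * Fintype.card U₃))
    (sh : ∑ a, ∑ b, h a b ≤ ε / 3 * (Fintype.card U₃ * Fintype.card U₁)) :
    ∃ a b c, f a b ≤ ε ∧ g b c ≤ ε ∧ h c a ≤ ε := by
  have hsum : ∑ p : U₁ × U₂ × U₃, (f p.1 p.2.1 + g p.2.1 p.2.2 + h p.2.2 p.1) ≤
      ∑ _p : U₁ × U₂ × U₃, ε := by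
    have hcomm : ∑ a, ∑ c, h c a = ∑ c, ∑ a, h c a := sum_comm
    simp only [sum_add_distrib, Fintype.sum_prod_type, sum_const, card_univ, nsmul_eq_mul,
      ← mul_sum, hcomm, Fintype.card_prod, Nat.cast_mul]
    linarith [mul_le_mul_of_nonneg_right sf (Nat.cast_nonneg (α := ℝ) (Fintype.card U₃)),
      mul_le_mul_of_nonneg_right sg (Nat.cast_nonneg (α := ℝ) (Fintype.card U₁)),
      mul_le_mul_of_nonneg_right sh (Nat.cast_nonneg (α := ℝ) (Fintype.card U₂))]
  obtain ⟨⟨a, b, c⟩, -, habc⟩ := exists_le_of_sum_le univ_nonempty hsum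
  have := hf a b
  have := hg b c
  have := hh c a
  exact ⟨a, b, c, by linarith, by linarith, by linarith⟩

/-- The proportion of pairs in `V × V'` which, at fixed levels `u` and `u'` of the blow-ups
`V × U` and `V' × U'`, belong to `E` but not to the approximation given by the colourings. -/
noncomputable def sliceError {V V' U U' : Type*} [Fintype V] [Fintype V'] {M : ℕ}
    (E : Finset (V × V')) (c : V × U → Fin M) (c' : V' × U' → Fin M) (S : Fin M → Fin M → Prop)
    (u : U) (u' : U') : ℝ :=
  #{p : V × V' | (p.1, p.2) ∈ E ∧ ¬ S (c (p.1, u)) (c' (p.2, u'))} / (Fintype.card V * Fintype.card V')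

lemma sum_sliceError_le {V V' U U' : Type*} [Fintype V] [Fintype V'] [Fintype U] [Fintype U']
    [Nonempty V] [Nonempty V'] {M n : ℕ} {ε : ℝ} {E : Finset (V × V')} {c : V × U → Fin M}
    {c' : V' × U' → Fin M} {S : Fin M → Fin M → Prop}
    (hn : Fintype.card V * Fintype.card U = n) (hn' : Fintype.card V' * Fintype.card U' = n)
    (h : (#{p : (V × U) × (V' × U') | (p.1.1, p.2.1) ∈ E ∧ ¬ S (c p.1) (c' p.2)} : ℝ) ≤
      ε * n ^ 2) :
    ∑ u, ∑ u', sliceError E c c' S u u' ≤ ε * (Fintype.card U * Fintype.card U') := by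
  have hslice := sum_card_slice fun (x : V × U) (y : V' × U') ↦
    (x.1, y.1) ∈ E ∧ ¬ S (c x) (c' y)
  rw [← hslice, sq] at h
  nth_rewrite 1 [← hn] at h
  rw [← hn'] at h
  push_cast at h
  have pos : 0 < (Fintype.card V : ℝ) := mod_cast Fintype.card_pos
  have pos' : 0 < (Fintype.card V' : ℝ) := mod_cast Fintype.card_pos
  simp only [sliceError, ← sum_div]
  rw [div_le_iff₀ (by positivity)]
  exact h.trans_eq (by ring)

lemma card_sdiff_le_of_sliceError_le {V V' U U' : Type*} [Fintype V] [Fintype V'] [Nonempty V]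
    [Nonempty V'] {M : ℕ} {ε : ℝ} {E : Finset (V × V')} {c : V × U → Fin M}
    {c' : V' × U' → Fin M} {S : Fin M → Fin M → Prop} {u : U} {u' : U'}
    (h : sliceError E c c' S u u' ≤ ε) :
    (#(E \ ({p | S (c (p.1, u)) (c' (p.2, u'))} : Finset (V × V'))) : ℝ) ≤
      ε * Fintype.card V * Fintype.card V' := by
  have pos : 0 < (Fintype.card V : ℝ) := mod_cast Fintype.card_pos
  have pos' : 0 < (Fintype.card V' : ℝ) := mod_cast Fintype.card_pos
  rw [sliceError, div_le_iff₀ (by positivity), ← mul_assoc] at h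
  refine (Nat.cast_le.2 (card_le_card fun p hp ↦ ?_)).trans h
  simpa using hp

lemma exists_eq_biUnion_fibers {V V' : Type*} [Fintype V] [Fintype V'] {M : ℕ} (d : V → Fin M)
    (d' : V' → Fin M) (S : Fin M → Fin M → Prop) :
    ∃ T : Finset (Fin M × Fin M), ({p | S (d p.1) (d' p.2)} : Finset (V × V')) =
      T.biUnion (fun ab : Fin M × Fin M ↦ ({x | d x = ab.1} : Finset V) ×ˢ
        ({x | d' x = ab.2} : Finset V')) := by
  refine ⟨univ.filter fun ab ↦ S ab.1 ab.2, ?_⟩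
  ext ⟨x, y⟩
  simp

lemma card_blowup_triangles_le {V1 V2 V3 U1 U2 U3 : Type*} [Fintype V1] [Fintype V2] [Fintype V3]
    [Fintype U1] [Fintype U2] [Fintype U3] {n : ℕ} {δ : ℝ} {E12 : Finset (V1 × V2)}
    {E23 : Finset (V2 × V3)} {E31 : Finset (V3 × V1)}
    (card1 : Fintype.card V1 * Fintype.card U1 = n) (card2 : Fintype.card V2 * Fintype.card U2 = n)
    (card3 : Fintype.card V3 * Fintype.card U3 = n)
    (htri : (#{p : V1 × V2 × V3 | (p.1, p.2.1) ∈ E12 ∧ (p.2.1, p.2.2) ∈ E23 ∧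
      (p.2.2, p.1) ∈ E31} : ℝ) ≤ δ * Fintype.card V1 * Fintype.card V2 * Fintype.card V3) :
    (#{p : (V1 × U1) × (V2 × U2) × (V3 × U3) | (p.1.1, p.2.1.1) ∈ E12 ∧
      (p.2.1.1, p.2.2.1) ∈ E23 ∧ (p.2.2.1, p.1.1) ∈ E31} : ℝ) ≤ δ * n ^ 3 := by
  have hle := card_le_card_of_injOn
    (s := {p : (V1 × U1) × (V2 × U2) × (V3 × U3) | (p.1.1, p.2.1.1) ∈ E12 ∧
      (p.2.1.1, p.2.2.1) ∈ E23 ∧ (p.2.2.1, p.1.1) ∈ E31})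
    (t := ({p : V1 × V2 × V3 | (p.1, p.2.1) ∈ E12 ∧ (p.2.1, p.2.2) ∈ E23 ∧
      (p.2.2, p.1) ∈ E31} : Finset _) ×ˢ (univ : Finset (U1 × U2 × U3)))
    (fun p ↦ ((p.1.1, p.2.1.1, p.2.2.1), (p.1.2, p.2.1.2, p.2.2.2)))
    (fun p hp ↦ by
      rw [mem_coe, mem_filter] at hp
      exact mem_product.2 ⟨mem_filter.2 ⟨mem_univ _, hp.2⟩, mem_univ _⟩)
    (fun p _ q _ h ↦ by simp only [Prod.ext_iff] at h ⊢; tauto)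
  rw [card_product, card_univ, Fintype.card_prod U1, Fintype.card_prod U2] at hle
  have hle' : (_ : ℝ) ≤ _ := Nat.cast_le.2 hle
  push_cast at hle'
  refine hle'.trans ((mul_le_mul_of_nonneg_right htri (by positivity)).trans_eq ?_)
  rw [pow_three]
  nth_rewrite 1 [← card1]
  nth_rewrite 1 [← card2]
  rw [← card3]
  push_cast
  ring

lemma exists_coloring_of_blowup {V1 V2 V3 U1 U2 U3 : Type*} [Fintype V1] [Fintype V2] [Fintype V3]
    [Fintype U1] [Fintype U2] [Fintype U3] [Nonempty V1] [Nonempty V2] [Nonempty V3]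
    [Nonempty U1] [Nonempty U2] [Nonempty U3] {M n : ℕ} {ε : ℝ} {E12 : Finset (V1 × V2)}
    {E23 : Finset (V2 × V3)} {E31 : Finset (V3 × V1)} {c₁ : V1 × U1 → Fin M} {c₂ : V2 × U2 → Fin M}
    {c₃ : V3 × U3 → Fin M} {S₁₂ S₂₃ S₃₁ : Fin M → Fin M → Prop}
    (card1 : Fintype.card V1 * Fintype.card U1 = n) (card2 : Fintype.card V2 * Fintype.card U2 = n)
    (card3 : Fintype.card V3 * Fintype.card U3 = n)
    (hfree : ∀ x y z, ¬ (S₁₂ (c₁ x) (c₂ y) ∧ S₂₃ (c₂ y) (c₃ z) ∧ S₃₁ (c₃ z) (c₁ x)))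
    (h₁₂ : (#{p : (V1 × U1) × (V2 × U2) | (p.1.1, p.2.1) ∈ E12 ∧ ¬ S₁₂ (c₁ p.1) (c₂ p.2)} : ℝ) ≤
      ε / 3 * n ^ 2)
    (h₂₃ : (#{p : (V2 × U2) × (V3 × U3) | (p.1.1, p.2.1) ∈ E23 ∧ ¬ S₂₃ (c₂ p.1) (c₃ p.2)} : ℝ) ≤
      ε / 3 * n ^ 2)
    (h₃₁ : (#{p : (V3 × U3) × (V1 × U1) | (p.1.1, p.2.1) ∈ E31 ∧ ¬ S₃₁ (c₃ p.1) (c₁ p.2)} : ℝ) ≤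
      ε / 3 * n ^ 2) :
    ∃ (d₁ : V1 → Fin M) (d₂ : V2 → Fin M) (d₃ : V3 → Fin M),
      (∀ x y z, ¬ (S₁₂ (d₁ x) (d₂ y) ∧ S₂₃ (d₂ y) (d₃ z) ∧ S₃₁ (d₃ z) (d₁ x))) ∧
      (#(E12 \ ({p | S₁₂ (d₁ p.1) (d₂ p.2)} : Finset (V1 × V2))) : ℝ) ≤
        ε * Fintype.card V1 * Fintype.card V2 ∧
      (#(E23 \ ({p | S₂₃ (d₂ p.1) (d₃ p.2)} : Finset (V2 × V3))) : ℝ) ≤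
        ε * Fintype.card V2 * Fintype.card V3 ∧
      (#(E31 \ ({p | S₃₁ (d₃ p.1) (d₁ p.2)} : Finset (V3 × V1))) : ℝ) ≤
        ε * Fintype.card V3 * Fintype.card V1 := by
  obtain ⟨u₁, u₂, u₃, b₁₂, b₂₃, b₃₁⟩ := exists_forall_le_of_sum_le
    (fun u u' ↦ sliceError E12 c₁ c₂ S₁₂ u u') (fun u u' ↦ sliceError E23 c₂ c₃ S₂₃ u u')
    (fun u u' ↦ sliceError E31 c₃ c₁ S₃₁ u u') (fun _ _ ↦ by unfold sliceError; positivity)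
    (fun _ _ ↦ by unfold sliceError; positivity) (fun _ _ ↦ by unfold sliceError; positivity)
    (sum_sliceError_le card1 card2 h₁₂) (sum_sliceError_le card2 card3 h₂₃)
    (sum_sliceError_le card3 card1 h₃₁)
  exact ⟨fun x ↦ c₁ (x, u₁), fun x ↦ c₂ (x, u₂), fun x ↦ c₃ (x, u₃), fun _ _ _ ↦ hfree _ _ _,
    card_sdiff_le_of_sliceError_le b₁₂, card_sdiff_le_of_sliceError_le b₂₃,
    card_sdiff_le_of_sliceError_le b₃₁⟩

theorem exists_coloring_of_few_triangles {ε : ℝ} (hε : 0 < ε) :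
    ∃ δ : ℝ, 0 < δ ∧ ∃ M : ℕ, 0 < M ∧ ∀ (V1 V2 V3 : Type) [Fintype V1] [Fintype V2] [Fintype V3]
      [Nonempty V1] [Nonempty V2] [Nonempty V3]
      (E12 : Finset (V1 × V2)) (E23 : Finset (V2 × V3)) (E31 : Finset (V3 × V1)),
      (#{p : V1 × V2 × V3 | (p.1, p.2.1) ∈ E12 ∧ (p.2.1, p.2.2) ∈ E23 ∧
        (p.2.2, p.1) ∈ E31} : ℝ) ≤ δ * Fintype.card V1 * Fintype.card V2 * Fintype.card V3 →
      ∃ (d₁ : V1 → Fin M) (d₂ : V2 → Fin M) (d₃ : V3 → Fin M) (S₁₂ S₂₃ S₃₁ : Fin M → Fin M → Prop),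
        (∀ x y z, ¬ (S₁₂ (d₁ x) (d₂ y) ∧ S₂₃ (d₂ y) (d₃ z) ∧ S₃₁ (d₃ z) (d₁ x))) ∧
        (#(E12 \ ({p | S₁₂ (d₁ p.1) (d₂ p.2)} : Finset (V1 × V2))) : ℝ) ≤
          ε * Fintype.card V1 * Fintype.card V2 ∧
        (#(E23 \ ({p | S₂₃ (d₂ p.1) (d₃ p.2)} : Finset (V2 × V3))) : ℝ) ≤
          ε * Fintype.card V2 * Fintype.card V3 ∧
        (#(E31 \ ({p | S₃₁ (d₃ p.1) (d₁ p.2)} : Finset (V3 × V1))) : ℝ) ≤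
          ε * Fintype.card V3 * Fintype.card V1 := by
  obtain ⟨δ, hδ, M, L, hM, key⟩ :=
    exists_tripartite_coloring_approximation (by positivity : 0 < ε / 3)
  refine ⟨δ, hδ, M, hM, fun V1 V2 V3 _ _ _ _ _ _ E12 E23 E31 htri ↦ ?_⟩
  have pos1 : 0 < Fintype.card V1 := Fintype.card_pos
  have pos2 : 0 < Fintype.card V2 := Fintype.card_pos
  have pos3 : 0 < Fintype.card V3 := Fintype.card_pos
  obtain ⟨n, k₁, k₂, k₃, hLn, hk₁, hk₂, hk₃, card1, card2, card3⟩ : ∃ n k₁ k₂ k₃ : ℕ, L < n ∧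
      0 < k₁ ∧ 0 < k₂ ∧ 0 < k₃ ∧ Fintype.card V1 * k₁ = n ∧ Fintype.card V2 * k₂ = n ∧
      Fintype.card V3 * k₃ = n := by
    refine ⟨Fintype.card V1 * Fintype.card V2 * Fintype.card V3 * (L + 1),
      Fintype.card V2 * Fintype.card V3 * (L + 1), Fintype.card V3 * Fintype.card V1 * (L + 1),
      Fintype.card V1 * Fintype.card V2 * (L + 1),
      Nat.le_mul_of_pos_left (L + 1) (by positivity), by positivity, by positivity, by positivity,
      by ring, by ring, by ring⟩
  have : Nonempty (Fin k₁) := Fin.pos_iff_nonempty.1 hk₁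
  have : Nonempty (Fin k₂) := Fin.pos_iff_nonempty.1 hk₂
  have : Nonempty (Fin k₃) := Fin.pos_iff_nonempty.1 hk₃
  rw [← Fintype.card_fin k₁] at card1
  rw [← Fintype.card_fin k₂] at card2
  rw [← Fintype.card_fin k₃] at card3
  obtain ⟨c₁, c₂, c₃, S₁₂, S₂₃, S₃₁, hfree, h₁₂, h₂₃, h₃₁⟩ :=
    key (V1 × Fin k₁) (V2 × Fin k₂) (V3 × Fin k₃) n (fun x y ↦ (x.1, y.1) ∈ E12)
      (fun x y ↦ (x.1, y.1) ∈ E23) (fun x y ↦ (x.1, y.1) ∈ E31)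
      ((Fintype.card_prod _ _).trans card1) ((Fintype.card_prod _ _).trans card2)
      ((Fintype.card_prod _ _).trans card3) (L.zero_le.trans_lt hLn) hLn.le
      (by convert card_blowup_triangles_le card1 card2 card3 htri)
  obtain ⟨d₁, d₂, d₃, hd⟩ :=
    exists_coloring_of_blowup card1 card2 card3 hfree (E12 := E12) (E23 := E23) (E31 := E31)
      (by convert h₁₂) (by convert h₂₃) (by convert h₃₁)
  exact ⟨d₁, d₂, d₃, S₁₂, S₂₃, S₃₁, hd⟩

/-- **Strong triangle removal lemma, tripartite graph version.**
As the triangle removal lemma, but additionally the triangle-free approximation can be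
taken to be of bounded complexity: there are partitions of each `Vi` into `M` (possibly
empty) pieces such that each `E'ij` is a union of products of pieces. -/
theorem strong_triangle_removal_tripartite :
    ∀ ε : ℝ, 0 < ε → ∃ δ : ℝ, 0 < δ ∧ ∃ M : ℕ, 0 < M ∧
      ∀ (V1 V2 V3 : Type) [Fintype V1] [Fintype V2] [Fintype V3]
        [Nonempty V1] [Nonempty V2] [Nonempty V3]
        (E12 : Finset (V1 × V2)) (E23 : Finset (V2 × V3)) (E31 : Finset (V3 × V1)),
        ((Finset.univ.filter (fun p : V1 × V2 × V3 =>
            (p.1, p.2.1) ∈ E12 ∧ (p.2.1, p.2.2) ∈ E23 ∧ (p.2.2, p.1) ∈ E31)).card : ℝ)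
            ≤ δ * Fintype.card V1 * Fintype.card V2 * Fintype.card V3 →
        ∃ (E'12 : Finset (V1 × V2)) (E'23 : Finset (V2 × V3)) (E'31 : Finset (V3 × V1)),
          (∀ (x1 : V1) (x2 : V2) (x3 : V3),
            ¬ ((x1, x2) ∈ E'12 ∧ (x2, x3) ∈ E'23 ∧ (x3, x1) ∈ E'31)) ∧
          ((E12 \ E'12).card : ℝ) ≤ ε * Fintype.card V1 * Fintype.card V2 ∧
          ((E23 \ E'23).card : ℝ) ≤ ε * Fintype.card V2 * Fintype.card V3 ∧
          ((E31 \ E'31).card : ℝ) ≤ ε * Fintype.card V3 * Fintype.card V1 ∧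
          ∃ (P1 : Fin M → Finset V1) (P2 : Fin M → Finset V2) (P3 : Fin M → Finset V3),
            (∀ x : V1, ∃! a : Fin M, x ∈ P1 a) ∧
            (∀ x : V2, ∃! a : Fin M, x ∈ P2 a) ∧
            (∀ x : V3, ∃! a : Fin M, x ∈ P3 a) ∧
            (∃ S12 : Finset (Fin M × Fin M),
              E'12 = S12.biUnion (fun ab => P1 ab.1 ×ˢ P2 ab.2)) ∧
            (∃ S23 : Finset (Fin M × Fin M),
              E'23 = S23.biUnion (fun ab => P2 ab.1 ×ˢ P3 ab.2)) ∧
            (∃ S31 : Finset (Fin M × Fin M),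
              E'31 = S31.biUnion (fun ab => P3 ab.1 ×ˢ P1 ab.2)) := by
  intro ε hε
  obtain ⟨δ, hδ, M, hM, key⟩ := exists_coloring_of_few_triangles hε
  refine ⟨δ, hδ, M, hM, fun V1 V2 V3 _ _ _ _ _ _ E12 E23 E31 htri ↦ ?_⟩
  obtain ⟨d₁, d₂, d₃, S₁₂, S₂₃, S₃₁, hd, b₁₂, b₂₃, b₃₁⟩ := key V1 V2 V3 E12 E23 E31 htri
  refine ⟨univ.filter fun p ↦ S₁₂ (d₁ p.1) (d₂ p.2), univ.filter fun p ↦ S₂₃ (d₂ p.1) (d₃ p.2),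
    univ.filter fun p ↦ S₃₁ (d₃ p.1) (d₁ p.2), fun x y z ↦ ?_, b₁₂, b₂₃, b₃₁,
    fun a ↦ univ.filter fun x ↦ d₁ x = a, fun a ↦ univ.filter fun x ↦ d₂ x = a,
    fun a ↦ univ.filter fun x ↦ d₃ x = a, ?_, ?_, ?_, exists_eq_biUnion_fibers d₁ d₂ S₁₂,
    exists_eq_biUnion_fibers d₂ d₃ S₂₃, exists_eq_biUnion_fibers d₃ d₁ S₃₁⟩
  · simpa using hd x y z
  all_goals simp
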